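/- The 10-dimensional spinor variety S^{10} ⊂ ℙ^{15} is not scheme-theoretically defined by 8 quadric hypersurfaces; that is, there do not exist 8 quadrics in ℙ^{15} whose scheme-theoretic intersection equals S^{10}. -/

import Mathlib

/-!
Common framework for formalizing "Quadratic Varieties of Small Codimension"
(K. Watanabe), following Ionescu–Russo.

We model a projective variety as a subset of the complex projective space
`PS m := ℙ ℂ (Fin m → ℂ)` (which is `ℙ^{m-1}`, with `m` homogeneous coordinates).
-/

noncomputable section

open scoped BigOperators

/-- Complex projective space `ℙ^{m-1}`, described by `m` homogeneous coordinates. -/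
abbrev PS (m : ℕ) : Type := Projectivization ℂ (Fin m → ℂ)

namespace PaperQV

/-- A polynomial vanishes at a point of projective space, i.e. on the whole
corresponding line in affine space. -/
def PVanish {m : ℕ} (p : MvPolynomial (Fin m) ℂ) (x : PS m) : Prop :=
  ∀ v ∈ x.submodule, MvPolynomial.eval v p = 0

/-- The common zero locus, in projective space, of a set of polynomials. -/
def ZeroLocus {m : ℕ} (P : Set (MvPolynomial (Fin m) ℂ)) : Set (PS m) :=
  {x | ∀ p ∈ P, PVanish p x}

/-- Zariski-closed subsets of projective space. -/
def ZClosed {m : ℕ} (S : Set (PS m)) : Prop :=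
  ∃ P : Set (MvPolynomial (Fin m) ℂ), S = ZeroLocus P

/-- Zariski closure. -/
def ZClosure {m : ℕ} (S : Set (PS m)) : Set (PS m) :=
  ⋂₀ {C | ZClosed C ∧ S ⊆ C}

/-- Irreducibility with respect to the Zariski topology. -/
def ZIrreducible {m : ℕ} (S : Set (PS m)) : Prop :=
  S.Nonempty ∧ ∀ C₁ C₂ : Set (PS m), ZClosed C₁ → ZClosed C₂ → S ⊆ C₁ ∪ C₂ →
    S ⊆ C₁ ∨ S ⊆ C₂

/-- `X` contains a strictly increasing chain of `n + 1` irreducible Zariski-closed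
subsets, i.e. `dim X ≥ n`. -/
def DimGE {m : ℕ} (X : Set (PS m)) (n : ℕ) : Prop :=
  ∃ c : Fin (n + 1) → Set (PS m),
    StrictMono c ∧ ∀ i, ZClosed (c i) ∧ ZIrreducible (c i) ∧ c i ⊆ X

/-- `X` has dimension exactly `n`. -/
def HasDim {m : ℕ} (X : Set (PS m)) (n : ℕ) : Prop :=
  DimGE X n ∧ ¬ DimGE X (n + 1)

/-- The differential of a polynomial `p` at the vector `v`, as a linear functional. -/
def polyDiff {m : ℕ} (p : MvPolynomial (Fin m) ℂ) (v : Fin m → ℂ) :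
    (Fin m → ℂ) →ₗ[ℂ] ℂ :=
  ∑ j, MvPolynomial.eval v (MvPolynomial.pderiv j p) • LinearMap.proj j

/-- The Zariski tangent space at `x ∈ X` of the affine cone over `X`:
the intersection of the kernels of the differentials at `x.rep` of all
polynomials vanishing on `X`. -/
def tangentSubmodule {m : ℕ} (X : Set (PS m)) (x : PS m) :
    Submodule ℂ (Fin m → ℂ) :=
  ⨅ (p : MvPolynomial (Fin m) ℂ) (_ : ∀ y ∈ X, PVanish p y),
    LinearMap.ker (polyDiff p x.rep)

/-- `X ⊆ ℙ^{m-1}` is a smooth projective variety of dimension `n`: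
it is Zariski closed, irreducible, of dimension `n`, and at every point the
Zariski tangent space of its affine cone has dimension `n + 1`. -/
def SmoothVariety {m : ℕ} (X : Set (PS m)) (n : ℕ) : Prop :=
  ZClosed X ∧ ZIrreducible X ∧ HasDim X n ∧
    ∀ x ∈ X, Module.finrank ℂ (tangentSubmodule X x) = n + 1

/-- `X` is nondegenerate: it is contained in no hyperplane. -/
def Nondegenerate {m : ℕ} (X : Set (PS m)) : Prop :=
  ∀ φ : (Fin m → ℂ) →ₗ[ℂ] ℂ, (∀ x ∈ X, ∀ v ∈ x.submodule, φ v = 0) → φ = 0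

/-- The hypersurfaces `Q i = 0` cut out `X` scheme-theoretically: `X` is their
set-theoretic intersection, and at every point of `X` the `Q i` realize the full
Zariski tangent space (i.e. their differentials span the conormal space, so they
generate the ideal sheaf of the smooth variety `X`). -/
def SchemeCutOutBy {m k : ℕ} (X : Set (PS m)) (Q : Fin k → MvPolynomial (Fin m) ℂ) : Prop :=
  X = {x | ∀ i, PVanish (Q i) x} ∧
    ∀ x ∈ X, ∀ p : MvPolynomial (Fin m) ℂ, (∀ y ∈ X, PVanish p y) →
      (⨅ i, LinearMap.ker (polyDiff (Q i) x.rep)) ≤ LinearMap.ker (polyDiff p x.rep)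

/-- `X` is scheme-theoretically defined by `c` (linearly) independent quadratic equations. -/
def CutOutByQuadrics {m : ℕ} (X : Set (PS m)) (c : ℕ) : Prop :=
  ∃ Q : Fin c → MvPolynomial (Fin m) ℂ,
    (∀ i, (Q i).IsHomogeneous 2) ∧ LinearIndependent ℂ Q ∧ SchemeCutOutBy X Q

/-- A quadratic variety: scheme-theoretically an intersection of quadrics. -/
def IsQuadratic {m : ℕ} (X : Set (PS m)) : Prop :=
  ∃ c : ℕ, CutOutByQuadrics X c

/-- `X ⊆ ℙ^{m-1}` of dimension `n` is a complete intersection: it is cut out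
scheme-theoretically by exactly `codim X = (m - 1) - n` hypersurfaces. -/
def IsCompleteIntersection {m : ℕ} (X : Set (PS m)) (n : ℕ) : Prop :=
  ∃ F : Fin (m - 1 - n) → MvPolynomial (Fin m) ℂ, ∃ d : Fin (m - 1 - n) → ℕ,
    (∀ i, (F i).IsHomogeneous (d i)) ∧ (∀ i, 1 ≤ d i) ∧ SchemeCutOutBy X F

/-- Lines in projective space: projectivizations of 2-dimensional subspaces. -/
def IsLine {m : ℕ} (L : Set (PS m)) : Prop :=
  ∃ W : Submodule ℂ (Fin m → ℂ), Module.finrank ℂ W = 2 ∧ L = {x | x.submodule ≤ W}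

/-- `X` is covered by lines. -/
def CoveredByLines {m : ℕ} (X : Set (PS m)) : Prop :=
  ∀ x ∈ X, ∃ L : Set (PS m), IsLine L ∧ x ∈ L ∧ L ⊆ X

/-- `X` and `Y` are projectively equivalent (via a linear isomorphism of the
ambient homogeneous coordinate spaces). -/
def ProjEquiv {m₁ m₂ : ℕ} (X : Set (PS m₁)) (Y : Set (PS m₂)) : Prop :=
  ∃ (f : (Fin m₁ → ℂ) →ₗ[ℂ] (Fin m₂ → ℂ)) (hf : Function.Injective f),
    Function.Surjective f ∧ Projectivization.map f hf '' X = Y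

/-- `X ⊆ ℙ^{m₁-1}` is projectively equivalent to a hyperplane section of
`S ⊆ ℙ^{m₂-1}`: a linear embedding of the ambient space of `X` onto a hyperplane
carries `X` onto the corresponding hyperplane section of `S`. -/
def ProjEquivToHyperplaneSection {m₁ m₂ : ℕ} (X : Set (PS m₁)) (S : Set (PS m₂)) : Prop :=
  ∃ (f : (Fin m₁ → ℂ) →ₗ[ℂ] (Fin m₂ → ℂ)) (hf : Function.Injective f),
    Module.finrank ℂ (LinearMap.range f) + 1 = m₂ ∧
    Projectivization.map f hf '' X = S ∩ {y | y.submodule ≤ LinearMap.range f}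

/-! ### Explicit varieties: the Segre 3-fold, the Grassmannian `G(2,ℂ⁵)`,
the 10-dimensional spinor variety, cones, and Gushel–Mukai 6-folds. -/

/-- Index bookkeeping for the Segre embedding `ℙ¹ × ℙ² → ℙ⁵`. -/
def segreIdx : Fin 6 → Fin 2 × Fin 3 :=
  ![(0, 0), (0, 1), (0, 2), (1, 0), (1, 1), (1, 2)]

/-- The Segre coordinates of a pair of vectors. -/
def segreVec (a : Fin 2 → ℂ) (b : Fin 3 → ℂ) : Fin 6 → ℂ :=
  fun k => a (segreIdx k).1 * b (segreIdx k).2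

/-- The Segre 3-fold `ℙ¹ × ℙ² ⊆ ℙ⁵`. -/
def Segre12 : Set (PS 6) :=
  {x | ∃ (a : Fin 2 → ℂ) (b : Fin 3 → ℂ) (hv : segreVec a b ≠ 0),
    x = Projectivization.mk ℂ (segreVec a b) hv}

/-- The pairs `i < j` in `Fin 5`, indexing Plücker coordinates. -/
def pluckerPair : Fin 10 → Fin 5 × Fin 5 :=
  ![(0, 1), (0, 2), (0, 3), (0, 4), (1, 2), (1, 3), (1, 4), (2, 3), (2, 4), (3, 4)]

/-- The Plücker coordinates of the 2-plane spanned by `a`, `b` in `ℂ⁵`. -/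
def pluckerVec (a b : Fin 5 → ℂ) : Fin 10 → ℂ :=
  fun k => a (pluckerPair k).1 * b (pluckerPair k).2
    - a (pluckerPair k).2 * b (pluckerPair k).1

/-- The Grassmannian `G(2, ℂ⁵) ⊆ ℙ⁹` in its Plücker embedding. -/
def Grass25 : Set (PS 10) :=
  {x | ∃ (a b : Fin 5 → ℂ) (hv : pluckerVec a b ≠ 0),
    x = Projectivization.mk ℂ (pluckerVec a b) hv}

/-- `pfc i` lists the four elements of `Fin 5 \ {i}`, in increasing order. -/
def pfc : Fin 5 → Fin 4 → Fin 5 :=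
  ![![1, 2, 3, 4], ![0, 2, 3, 4], ![0, 1, 3, 4], ![0, 1, 2, 4], ![0, 1, 2, 3]]

/-- The sub-Pfaffian of a (skew-symmetric) `5 × 5` matrix obtained by deleting
the `i`-th row and column. -/
def subPfaffian (A : Fin 5 → Fin 5 → ℂ) (i : Fin 5) : ℂ :=
  A (pfc i 0) (pfc i 1) * A (pfc i 2) (pfc i 3)
    - A (pfc i 0) (pfc i 2) * A (pfc i 1) (pfc i 3)
    + A (pfc i 0) (pfc i 3) * A (pfc i 1) (pfc i 2)

/-- The spinor coordinates `(1, (a_{ij})_{i<j}, (Pf_i(A))_i)` of a skew-symmetric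
`5 × 5` matrix: the affine parametrization of the spinor embedding. -/
def spinorTail (A : Fin 5 → Fin 5 → ℂ) : Fin 15 → ℂ :=
  (Fin.append (fun t : Fin 10 => A (pluckerPair t).1 (pluckerPair t).2)
    (subPfaffian A) : Fin (10 + 5) → ℂ)

def spinorVec (A : Fin 5 → Fin 5 → ℂ) : Fin 16 → ℂ :=
  fun k =>
    (Fin.cons (1 : ℂ) (spinorTail A) : Fin (15 + 1) → ℂ)
      (Fin.cast (show (16 : ℕ) = 15 + 1 by norm_num) k)

/-- The 10-dimensional spinor variety `S^{10} ⊆ ℙ^{15}`: the Zariski closure of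
the image of the space of skew-symmetric `5 × 5` matrices under the
sub-Pfaffian (spinor) parametrization. -/
def Spinor10 : Set (PS 16) :=
  ZClosure {x | ∃ A : Fin 5 → Fin 5 → ℂ, (∀ i j, A j i = - A i j) ∧
    ∃ hv : spinorVec A ≠ 0, x = Projectivization.mk ℂ (spinorVec A) hv}

/-- The cone with vertex `o` over a subset `Y` of projective space. -/
def ConeOver {m : ℕ} (o : PS m) (Y : Set (PS m)) : Set (PS m) :=
  {z | z = o ∨ ∃ y ∈ Y, z.submodule ≤ o.submodule ⊔ y.submodule}

/-- Gushel–Mukai 6-folds `Σ^6_{10} ⊆ ℙ^{10}`: smooth 6-dimensional sections of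
the cone over the Plücker-embedded `G(2,ℂ⁵) ⊆ ℙ⁹ ⊆ ℙ^{10}` by a smooth quadric
hypersurface. -/
def IsGushelMukai6 (W : Set (PS 11)) : Prop :=
  ∃ (f : (Fin 10 → ℂ) →ₗ[ℂ] (Fin 11 → ℂ)) (hf : Function.Injective f)
    (o : PS 11) (q : MvPolynomial (Fin 11) ℂ),
    ¬ o.submodule ≤ LinearMap.range f ∧
    q.IsHomogeneous 2 ∧
    (∀ v : Fin 11 → ℂ, MvPolynomial.eval v q = 0 →
      (∀ j, MvPolynomial.eval v (MvPolynomial.pderiv j q) = 0) → v = 0) ∧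
    W = ConeOver o (Projectivization.map f hf '' Grass25) ∩ {x | PVanish q x} ∧
    SmoothVariety W 6

/-! ### Lines through a point, the Hilbert scheme of lines `L_x`, general points. -/

/-- The line through `x` with direction vector `v` (the projectivization of the
span of `x` and `v`). -/
def LineThrough {m : ℕ} (x : PS m) (v : Fin m → ℂ) : Set (PS m) :=
  {y | y.submodule ≤ x.submodule ⊔ Submodule.span ℂ {v}}

/-- `W ⊆ ℙ^{n-1} = ℙ(T_x X)` is a model, via the tangent map, of the Hilbert
scheme `L_x` of lines on `X` through `x`:  a linear identification `j` of `ℂⁿ`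
with a complement of the line `x̂` inside the (affine cone) tangent space of `X`
at `x` carries `W` onto the set of tangent directions of lines on `X` through `x`. -/
def IsVMRTModel {m n : ℕ} (X : Set (PS m)) (x : PS m) (W : Set (PS n)) : Prop :=
  ∃ j : (Fin n → ℂ) →ₗ[ℂ] (Fin m → ℂ), Function.Injective j ∧
    LinearMap.range j ⊓ x.submodule = ⊥ ∧
    LinearMap.range j ⊔ x.submodule = tangentSubmodule X x ∧
    W = {u : PS n | LineThrough x (j u.rep) ⊆ X}

/-- `P` holds at all points of `X` off some proper Zariski-closed subset,
i.e. at a general point of `X`. -/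
def GenericallyOn {m : ℕ} (X : Set (PS m)) (P : PS m → Prop) : Prop :=
  ∃ C : Set (PS m), ZClosed C ∧ ¬ X ⊆ C ∧ ∀ x ∈ X \ C, P x

/-- The locus swept out by the lines on `X` through `x`. -/
def LocusOfLines {m : ℕ} (X : Set (PS m)) (x : PS m) : Set (PS m) :=
  ⋃₀ {L | IsLine L ∧ x ∈ L ∧ L ⊆ X}

/-! ### Products, morphisms, double covers, conics. -/

/-- Zariski-closed subsets of a product of projective spaces (cut out by
multihomogeneous polynomials in the two groups of variables). -/
def ZClosedProd {m₁ m₂ : ℕ} (S : Set (PS m₁ × PS m₂)) : Prop :=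
  ∃ P : Set (MvPolynomial (Fin m₁ ⊕ Fin m₂) ℂ),
    S = {z | ∀ p ∈ P, ∀ v ∈ z.1.submodule, ∀ w ∈ z.2.submodule,
      MvPolynomial.eval (Sum.elim v w) p = 0}

/-- `f` restricts to a morphism of projective varieties `X → Y`
(its graph over `X` is Zariski closed). -/
def IsMorphismOn {m₁ m₂ : ℕ} (X : Set (PS m₁)) (Y : Set (PS m₂))
    (f : PS m₁ → PS m₂) : Prop :=
  Set.MapsTo f X Y ∧ ZClosedProd {z : PS m₁ × PS m₂ | z.1 ∈ X ∧ z.2 = f z.1}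

/-- A double cover `X → Y`: a finite surjective morphism of degree `2`. -/
def IsDoubleCover {m₁ m₂ : ℕ} (X : Set (PS m₁)) (Y : Set (PS m₂))
    (f : PS m₁ → PS m₂) : Prop :=
  IsMorphismOn X Y f ∧ Set.SurjOn f X Y ∧
    (∀ y ∈ Y, {x | x ∈ X ∧ f x = y}.Finite) ∧
    GenericallyOn Y (fun y => {x | x ∈ X ∧ f x = y}.ncard = 2)

/-- Irreducible conics: irreducible plane sections of quadrics that are neither
lines nor full planes. -/
def IsIrreducibleConic {m : ℕ} (C : Set (PS m)) : Prop :=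
  ∃ (W : Submodule ℂ (Fin m → ℂ)) (q : MvPolynomial (Fin m) ℂ),
    Module.finrank ℂ W = 3 ∧ q.IsHomogeneous 2 ∧
    C = {x | x.submodule ≤ W ∧ PVanish q x} ∧
    ZIrreducible C ∧ ¬ IsLine C ∧ C ≠ {x | x.submodule ≤ W}

/-- "P holds for two general points of X." -/
def GenericallyOnPairs {m : ℕ} (X : Set (PS m)) (P : PS m → PS m → Prop) : Prop :=
  ∃ B : Set (PS m × PS m), ZClosedProd B ∧ ¬ X ×ˢ X ⊆ B ∧
    ∀ x ∈ X, ∀ y ∈ X, (x, y) ∉ B → P x y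

/-- `X` is conic-connected: through two general points of `X` there passes an
irreducible conic contained in `X`. -/
def ConicConnected {m : ℕ} (X : Set (PS m)) : Prop :=
  GenericallyOnPairs X fun x y =>
    ∃ C : Set (PS m), IsIrreducibleConic C ∧ C ⊆ X ∧ x ∈ C ∧ y ∈ C

/-- An interpretation of the transcendental / cohomological invariants of
embedded projective varieties used in the paper: being Fano, the Fano index,
`Pic ≅ ℤ`, degrees of normal bundles of lines, the degree, and conditions on
`H²`, `H⁴`, Chern classes and the second Chern character. -/
structure GeomInterp where
  /-- `X` is a Fano variety. -/
  IsFanoVariety : ∀ {m : ℕ}, Set (PS m) → Prop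
  /-- The Fano index of `X`: the maximal `r` such that `r` divides `-K_X` in `Pic X`. -/
  fanoIndex : ∀ {m : ℕ}, Set (PS m) → ℕ
  /-- `Pic X ≅ ℤ`. -/
  PicIsZ : ∀ {m : ℕ}, Set (PS m) → Prop
  /-- `deg N_{ℓ/X}`, the degree of the normal bundle of a line `ℓ ⊆ X`. -/
  normalBundleDeg : ∀ {m : ℕ}, Set (PS m) → Set (PS m) → ℤ
  /-- The degree of `X`, i.e. the self-intersection number `H^{dim X}`. -/
  degreeOf : ∀ {m : ℕ}, Set (PS m) → ℕ
  /-- `H²(X, ℤ) ≅ ℤ[H]`, generated by the hyperplane class. -/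
  H2GenByHyperplane : ∀ {m : ℕ}, Set (PS m) → Prop
  /-- `H⁴(X, ℤ) ≅ ℤ[H²]`. -/
  H4GenByHyperplaneSq : ∀ {m : ℕ}, Set (PS m) → Prop
  /-- `c₁(X) = a·H` in `H²(X, ℤ)`. -/
  c1Eq : ∀ {m : ℕ}, Set (PS m) → ℤ → Prop
  /-- `c₂(X) = a·H²` in `H⁴(X, ℤ)`. -/
  c2Eq : ∀ {m : ℕ}, Set (PS m) → ℤ → Prop
  /-- `ch₂(X) = (c₁(X)² - 2c₂(X))/2 = a·H²` in `H⁴(X, ℤ)`. -/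
  ch2Eq : ∀ {m : ℕ}, Set (PS m) → ℤ → Prop

end PaperQV

open PaperQV

namespace PaperQV

open MvPolynomial

/-- The Pfaffians of the skew-symmetric matrix with upper entries `x`. -/
def pfaffians (x : Fin 10 → ℂ) : Fin 5 → ℂ :=
  ![x 4 * x 9 - x 5 * x 8 + x 6 * x 7, x 1 * x 9 - x 2 * x 8 + x 3 * x 7,
    x 0 * x 9 - x 2 * x 6 + x 3 * x 5, x 0 * x 8 - x 1 * x 6 + x 3 * x 4,
    x 0 * x 7 - x 1 * x 5 + x 2 * x 4]

/-- The upper entries of the skew-symmetric matrix `b cᵀ - c bᵀ`. -/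
def wedge (b c : Fin 5 → ℂ) : Fin 10 → ℂ :=
  ![b 0 * c 1 - b 1 * c 0, b 0 * c 2 - b 2 * c 0, b 0 * c 3 - b 3 * c 0, b 0 * c 4 - b 4 * c 0,
    b 1 * c 2 - b 2 * c 1, b 1 * c 3 - b 3 * c 1, b 1 * c 4 - b 4 * c 1,
    b 2 * c 3 - b 3 * c 2, b 2 * c 4 - b 4 * c 2, b 3 * c 4 - b 4 * c 3]

/-- The vector of `ℂ¹⁶` with all three blocks of spinor coordinates prescribed. -/
def blockVec : (ℂ × (Fin 10 → ℂ) × (Fin 5 → ℂ)) →ₗ[ℂ] (Fin 16 → ℂ) where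
  toFun w := ![w.1, w.2.1 0, w.2.1 1, w.2.1 2, w.2.1 3, w.2.1 4, w.2.1 5, w.2.1 6, w.2.1 7,
    w.2.1 8, w.2.1 9, w.2.2 0, w.2.2 1, w.2.2 2, w.2.2 3, w.2.2 4]
  map_add' v w := by ext i; fin_cases i <;> rfl
  map_smul' t w := by ext i; fin_cases i <;> rfl

/-- The skew-symmetric matrix with upper entries `x`. -/
def skewOf (x : Fin 10 → ℂ) : Fin 5 → Fin 5 → ℂ :=
  ![![0, x 0, x 1, x 2, x 3], ![-x 0, 0, x 4, x 5, x 6], ![-x 1, -x 4, 0, x 7, x 8],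
    ![-x 2, -x 5, -x 7, 0, x 9], ![-x 3, -x 6, -x 8, -x 9, 0]]

lemma skewOf_skew (x : Fin 10 → ℂ) (i j : Fin 5) : skewOf x j i = -skewOf x i j := by
  fin_cases i <;> fin_cases j <;> simp [skewOf]

lemma spinorVec_eq_blockVec (A : Fin 5 → Fin 5 → ℂ) :
    spinorVec A = blockVec (1, fun t => A (pluckerPair t).1 (pluckerPair t).2,
      pfaffians fun t => A (pluckerPair t).1 (pluckerPair t).2) := by
  ext i
  fin_cases i <;> rfl

lemma spinorVec_skewOf (x : Fin 10 → ℂ) :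
    spinorVec (skewOf x) = blockVec (1, x, pfaffians x) := by
  ext i
  fin_cases i <;> rfl

lemma pfaffians_wedge (b c : Fin 5 → ℂ) : pfaffians (wedge b c) = 0 := by
  ext i
  fin_cases i <;> simp [pfaffians, wedge] <;> ring

lemma pfaffians_smul (t : ℂ) (x : Fin 10 → ℂ) : pfaffians (t • x) = t ^ 2 • pfaffians x := by
  ext i
  fin_cases i <;> simp [pfaffians] <;> ring

/-- A quadratic form as a bilinear form evaluated on the diagonal. -/
lemma exists_bilin_of_isHomogeneous_two {m : ℕ} {Q : MvPolynomial (Fin m) ℂ}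
    (hQ : Q.IsHomogeneous 2) :
    ∃ B : (Fin m → ℂ) →ₗ[ℂ] (Fin m → ℂ) →ₗ[ℂ] ℂ, ∀ v, eval v Q = B v v := by
  have hconst : ∀ j k, ∃ a : ℂ, pderiv k (pderiv j Q) = C a := fun j k =>
    ⟨_, totalDegree_eq_zero_iff_eq_C.mp
      (Nat.le_zero.mp ((hQ.pderiv (i := j)).pderiv (i := k)).totalDegree_le)⟩
  choose a ha using hconst
  refine ⟨Matrix.toLinearMap₂' ℂ (Matrix.of fun j k => a j k / 2), fun v => ?_⟩
  have h1 := congrArg (eval v) hQ.sum_X_mul_pderiv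
  have h2 : ∀ j, eval v (pderiv j Q) = ∑ k, v k * a j k := fun j => by
    have := congrArg (eval v) (hQ.pderiv (i := j)).sum_X_mul_pderiv
    simpa [ha] using this.symm
  simp only [map_sum, map_mul, eval_X, h2, nsmul_eq_mul, Nat.cast_ofNat, map_ofNat] at h1
  rw [Matrix.toLinearMap₂'_apply]
  have h3 : eval v Q = (∑ j, v j * ∑ k, v k * a j k) / 2 := by
    rw [h1]; ring
  rw [h3, Finset.sum_div]
  refine Finset.sum_congr rfl fun j _ => ?_
  rw [Finset.mul_sum, Finset.sum_div]
  refine Finset.sum_congr rfl fun k _ => ?_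
  simp
  ring

lemma sum_univ_ten (f : Fin 10 → ℂ) :
    ∑ t, f t = f 0 + f 1 + f 2 + f 3 + f 4 + f 5 + f 6 + f 7 + f 8 + f 9 := by
  simp only [Fin.sum_univ_castSucc, Finset.univ_eq_empty, Finset.sum_empty, zero_add]
  rfl

/-- The linear syzygies of the Pfaffians of a skew-symmetric `5 × 5` matrix. -/
lemma exists_of_pfaffian_syzygy (d : Fin 10 → Fin 5 → ℂ)
    (hd : ∀ x, ∑ t, ∑ k, x t * pfaffians x k * d t k = 0) :
    ∃ β : Fin 5 → ℂ, ∀ b c z : Fin 5 → ℂ, b ⬝ᵥ z = 0 → c ⬝ᵥ z = 1 →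
      ∑ t, ∑ k, wedge b c t * ![z 0, -z 1, z 2, -z 3, z 4] k * d t k = β ⬝ᵥ b := by
  have H : ∀ x0 x1 x2 x3 x4 x5 x6 x7 x8 x9 : ℂ, _ := fun x0 x1 x2 x3 x4 x5 x6 x7 x8 x9 =>
    hd ![x0, x1, x2, x3, x4, x5, x6, x7, x8, x9]
  simp only [Fin.sum_univ_five, sum_univ_ten, pfaffians, Matrix.cons_val] at H
  have h40 : d 4 0 = 0 := by
    linear_combination (1 / 2) * H 0 0 0 0 1 0 0 0 0 1 - (1 / 2) * H 0 0 0 0 1 0 0 0 0 (-1)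
  have h90 : d 9 0 = 0 := by
    linear_combination (1 / 2) * H 0 0 0 0 1 0 0 0 0 1 + (1 / 2) * H 0 0 0 0 1 0 0 0 0 (-1)
  have h50 : d 5 0 = 0 := by
    linear_combination (-1 / 2) * H 0 0 0 0 0 1 0 0 1 0 - (-1 / 2) * H 0 0 0 0 0 1 0 0 (-1) 0
  have h80 : d 8 0 = 0 := by
    linear_combination (-1 / 2) * H 0 0 0 0 0 1 0 0 1 0 + (-1 / 2) * H 0 0 0 0 0 1 0 0 (-1) 0
  have h60 : d 6 0 = 0 := by
    linear_combination (1 / 2) * H 0 0 0 0 0 0 1 1 0 0 - (1 / 2) * H 0 0 0 0 0 0 1 (-1) 0 0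
  have h70 : d 7 0 = 0 := by
    linear_combination (1 / 2) * H 0 0 0 0 0 0 1 1 0 0 + (1 / 2) * H 0 0 0 0 0 0 1 (-1) 0 0
  have h11 : d 1 1 = 0 := by
    linear_combination (1 / 2) * H 0 1 0 0 0 0 0 0 0 1 - (1 / 2) * H 0 1 0 0 0 0 0 0 0 (-1)
  have h91 : d 9 1 = 0 := by
    linear_combination (1 / 2) * H 0 1 0 0 0 0 0 0 0 1 + (1 / 2) * H 0 1 0 0 0 0 0 0 0 (-1)
  have h21 : d 2 1 = 0 := by
    linear_combination (-1 / 2) * H 0 0 1 0 0 0 0 0 1 0 - (-1 / 2) * H 0 0 1 0 0 0 0 0 (-1) 0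
  have h81 : d 8 1 = 0 := by
    linear_combination (-1 / 2) * H 0 0 1 0 0 0 0 0 1 0 + (-1 / 2) * H 0 0 1 0 0 0 0 0 (-1) 0
  have h31 : d 3 1 = 0 := by
    linear_combination (1 / 2) * H 0 0 0 1 0 0 0 1 0 0 - (1 / 2) * H 0 0 0 1 0 0 0 (-1) 0 0
  have h71 : d 7 1 = 0 := by
    linear_combination (1 / 2) * H 0 0 0 1 0 0 0 1 0 0 + (1 / 2) * H 0 0 0 1 0 0 0 (-1) 0 0
  have h02 : d 0 2 = 0 := by
    linear_combination (1 / 2) * H 1 0 0 0 0 0 0 0 0 1 - (1 / 2) * H 1 0 0 0 0 0 0 0 0 (-1)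
  have h92 : d 9 2 = 0 := by
    linear_combination (1 / 2) * H 1 0 0 0 0 0 0 0 0 1 + (1 / 2) * H 1 0 0 0 0 0 0 0 0 (-1)
  have h22 : d 2 2 = 0 := by
    linear_combination (-1 / 2) * H 0 0 1 0 0 0 1 0 0 0 - (-1 / 2) * H 0 0 1 0 0 0 (-1) 0 0 0
  have h62 : d 6 2 = 0 := by
    linear_combination (-1 / 2) * H 0 0 1 0 0 0 1 0 0 0 + (-1 / 2) * H 0 0 1 0 0 0 (-1) 0 0 0
  have h32 : d 3 2 = 0 := by
    linear_combination (1 / 2) * H 0 0 0 1 0 1 0 0 0 0 - (1 / 2) * H 0 0 0 1 0 (-1) 0 0 0 0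
  have h52 : d 5 2 = 0 := by
    linear_combination (1 / 2) * H 0 0 0 1 0 1 0 0 0 0 + (1 / 2) * H 0 0 0 1 0 (-1) 0 0 0 0
  have h03 : d 0 3 = 0 := by
    linear_combination (1 / 2) * H 1 0 0 0 0 0 0 0 1 0 - (1 / 2) * H 1 0 0 0 0 0 0 0 (-1) 0
  have h83 : d 8 3 = 0 := by
    linear_combination (1 / 2) * H 1 0 0 0 0 0 0 0 1 0 + (1 / 2) * H 1 0 0 0 0 0 0 0 (-1) 0
  have h13 : d 1 3 = 0 := by
    linear_combination (-1 / 2) * H 0 1 0 0 0 0 1 0 0 0 - (-1 / 2) * H 0 1 0 0 0 0 (-1) 0 0 0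
  have h63 : d 6 3 = 0 := by
    linear_combination (-1 / 2) * H 0 1 0 0 0 0 1 0 0 0 + (-1 / 2) * H 0 1 0 0 0 0 (-1) 0 0 0
  have h33 : d 3 3 = 0 := by
    linear_combination (1 / 2) * H 0 0 0 1 1 0 0 0 0 0 - (1 / 2) * H 0 0 0 1 (-1) 0 0 0 0 0
  have h43 : d 4 3 = 0 := by
    linear_combination (1 / 2) * H 0 0 0 1 1 0 0 0 0 0 + (1 / 2) * H 0 0 0 1 (-1) 0 0 0 0 0
  have h04 : d 0 4 = 0 := by
    linear_combination (1 / 2) * H 1 0 0 0 0 0 0 1 0 0 - (1 / 2) * H 1 0 0 0 0 0 0 (-1) 0 0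
  have h74 : d 7 4 = 0 := by
    linear_combination (1 / 2) * H 1 0 0 0 0 0 0 1 0 0 + (1 / 2) * H 1 0 0 0 0 0 0 (-1) 0 0
  have h14 : d 1 4 = 0 := by
    linear_combination (-1 / 2) * H 0 1 0 0 0 1 0 0 0 0 - (-1 / 2) * H 0 1 0 0 0 (-1) 0 0 0 0
  have h54 : d 5 4 = 0 := by
    linear_combination (-1 / 2) * H 0 1 0 0 0 1 0 0 0 0 + (-1 / 2) * H 0 1 0 0 0 (-1) 0 0 0 0
  have h24 : d 2 4 = 0 := by
    linear_combination (1 / 2) * H 0 0 1 0 1 0 0 0 0 0 - (1 / 2) * H 0 0 1 0 (-1) 0 0 0 0 0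
  have h44 : d 4 4 = 0 := by
    linear_combination (1 / 2) * H 0 0 1 0 1 0 0 0 0 0 + (1 / 2) * H 0 0 1 0 (-1) 0 0 0 0 0
  have h12 : d 1 2 = -d 0 1 := by
    linear_combination H 1 1 0 0 0 0 0 0 0 1 - h02 - h92 - (h11 + h91)
  have h23 : d 2 3 = d 0 1 := by
    linear_combination H 1 0 1 0 0 0 0 0 1 0 - h03 - h83 + (h21 + h81)
  have h34 : d 3 4 = -d 0 1 := by
    linear_combination H 1 0 0 1 0 0 0 1 0 0 - h04 - h74 - (h31 + h71)
  have h42 : d 4 2 = -d 0 0 := by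
    linear_combination H 1 0 0 0 1 0 0 0 0 1 - h02 - h92 - (h40 + h90)
  have h53 : d 5 3 = d 0 0 := by
    linear_combination H 1 0 0 0 0 1 0 0 1 0 - h03 - h83 + (h50 + h80)
  have h64 : d 6 4 = -d 0 0 := by
    linear_combination H 1 0 0 0 0 0 1 1 0 0 - h04 - h74 - (h60 + h70)
  have h41 : d 4 1 = -d 1 0 := by
    linear_combination H 0 1 0 0 1 0 0 0 0 1 - h11 - h91 - (h40 + h90)
  have h73 : d 7 3 = d 1 0 := by
    linear_combination (-1) * H 0 1 0 0 0 0 1 1 0 0 - h13 - h63 + (h70 + h60)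
  have h84 : d 8 4 = -d 1 0 := by
    linear_combination (-1) * H 0 1 0 0 0 1 0 0 1 0 - h14 - h54 - (h80 + h50)
  have h51 : d 5 1 = -d 2 0 := by
    linear_combination (-1) * H 0 0 1 0 0 1 0 0 1 0 - h21 - h81 - (h50 + h80)
  have h72 : d 7 2 = d 2 0 := by
    linear_combination (-1) * H 0 0 1 0 0 0 1 1 0 0 - h22 - h62 + (h70 + h60)
  have h94 : d 9 4 = -d 2 0 := by
    linear_combination H 0 0 1 0 1 0 0 0 0 1 - h24 - h44 - (h90 + h40)
  have h61 : d 6 1 = -d 3 0 := by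
    linear_combination H 0 0 0 1 0 0 1 1 0 0 - h31 - h71 - (h60 + h70)
  have h82 : d 8 2 = d 3 0 := by
    linear_combination H 0 0 0 1 0 1 0 0 1 0 - h32 - h52 + (h80 + h50)
  have h93 : d 9 3 = -d 3 0 := by
    linear_combination H 0 0 0 1 1 0 0 0 0 1 - h33 - h43 - (h90 + h40)
  refine ⟨![-d 0 1, -d 0 0, -d 1 0, -d 2 0, -d 3 0], fun b c z hbz hcz => ?_⟩
  simp only [dotProduct, Fin.sum_univ_five, sum_univ_ten, wedge, Matrix.cons_val] at hbz hcz ⊢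
  simp only [h40, h90, h50, h80, h60, h70, h11, h91, h21, h81, h31, h71, h02, h92, h22, h62,
    h32, h52, h03, h83, h13, h63, h33, h43, h04, h74, h14, h54, h24, h44, h12, h23, h34, h42,
    h53, h64, h41, h73, h84, h51, h72, h94, h61, h82, h93]
  linear_combination
    (-d 0 1 * b 0 - d 0 0 * b 1 - d 1 0 * b 2 - d 2 0 * b 3 - d 3 0 * b 4) * hcz
      - (-d 0 1 * c 0 - d 0 0 * c 1 - d 1 0 * c 2 - d 2 0 * c 3 - d 3 0 * c 4) * hbz

lemma eq_zero_of_pfaffians (c : Fin 5 → Fin 5 → ℂ)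
    (hc : ∀ x, ∑ k, ∑ l, pfaffians x k * pfaffians x l * c k l = 0) (y : Fin 5 → ℂ) :
    ∑ k, ∑ l, y k * y l * c k l = 0 := by
  have H : ∀ x0 x1 x2 x3 x4 x5 x6 x7 x8 x9 : ℂ, _ := fun x0 x1 x2 x3 x4 x5 x6 x7 x8 x9 =>
    hc ![x0, x1, x2, x3, x4, x5, x6, x7, x8, x9]
  simp only [Fin.sum_univ_five, pfaffians, Matrix.cons_val] at H
  have h00 : c 0 0 = 0 := by linear_combination H 0 0 0 0 1 0 0 0 0 1
  have h11 : c 1 1 = 0 := by linear_combination H 0 1 0 0 0 0 0 0 0 1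
  have h22 : c 2 2 = 0 := by linear_combination H 1 0 0 0 0 0 0 0 0 1
  have h33 : c 3 3 = 0 := by linear_combination H 1 0 0 0 0 0 0 0 1 0
  have h44 : c 4 4 = 0 := by linear_combination H 1 0 0 0 0 0 0 1 0 0
  have h01 : c 0 1 + c 1 0 = 0 := by
    linear_combination H 0 1 0 0 1 0 0 0 0 1 - h00 - h11
  have h02 : c 0 2 + c 2 0 = 0 := by
    linear_combination H 1 0 0 0 1 0 0 0 0 1 - h00 - h22
  have h03 : c 0 3 + c 3 0 = 0 := by
    linear_combination (-1) * H 1 0 0 0 0 1 0 0 1 0 + h00 + h33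
  have h04 : c 0 4 + c 4 0 = 0 := by
    linear_combination H 1 0 0 0 0 0 1 1 0 0 - h00 - h44
  have h12 : c 1 2 + c 2 1 = 0 := by
    linear_combination H 1 1 0 0 0 0 0 0 0 1 - h11 - h22
  have h13 : c 1 3 + c 3 1 = 0 := by
    linear_combination (-1) * H 1 0 1 0 0 0 0 0 1 0 + h11 + h33
  have h14 : c 1 4 + c 4 1 = 0 := by
    linear_combination H 1 0 0 1 0 0 0 1 0 0 - h11 - h44
  have h23 : c 2 3 + c 3 2 = 0 := by
    linear_combination H 0 1 1 0 0 0 1 0 0 0 - h22 - h33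
  have h24 : c 2 4 + c 4 2 = 0 := by
    linear_combination (-1) * H 0 1 0 1 0 1 0 0 0 0 + h22 + h44
  have h34 : c 3 4 + c 4 3 = 0 := by
    linear_combination H 0 0 1 1 1 0 0 0 0 0 - h33 - h44
  simp only [Fin.sum_univ_five]
  linear_combination y 0 ^ 2 * h00 + y 1 ^ 2 * h11 + y 2 ^ 2 * h22 + y 3 ^ 2 * h33 +
    y 4 ^ 2 * h44 + y 0 * y 1 * h01 + y 0 * y 2 * h02 + y 0 * y 3 * h03 + y 0 * y 4 * h04 +
    y 1 * y 2 * h12 + y 1 * y 3 * h13 + y 1 * y 4 * h14 + y 2 * y 3 * h23 + y 2 * y 4 * h24 +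
    y 3 * y 4 * h34

lemma bilin_apply_eq_sum {m n : ℕ} (B : (Fin m → ℂ) →ₗ[ℂ] (Fin n → ℂ) →ₗ[ℂ] ℂ)
    (x : Fin m → ℂ) (y : Fin n → ℂ) :
    B x y = ∑ t, ∑ k, x t * y k * B (Pi.single t 1) (Pi.single k 1) := by
  conv_lhs => rw [pi_eq_sum_univ' x, pi_eq_sum_univ' y]
  simp only [map_sum, map_smul, LinearMap.sum_apply, LinearMap.smul_apply, smul_eq_mul,
    Finset.mul_sum]
  rw [Finset.sum_comm]
  exact Finset.sum_congr rfl fun _ _ => Finset.sum_congr rfl fun _ _ => by ring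

lemma blockVec_eq (u : ℂ) (x : Fin 10 → ℂ) (y : Fin 5 → ℂ) :
    blockVec (u, x, y) = u • blockVec (1, 0, 0) + blockVec (0, x, 0) + blockVec (0, 0, y) := by
  rw [← map_smul, ← map_add, ← map_add]
  simp

/-- A quadratic form vanishing on the spinor variety, evaluated on certain secant vectors. -/
lemma exists_eval_secant {Q : MvPolynomial (Fin 16) ℂ} (hQ : Q.IsHomogeneous 2)
    (hv : ∀ x, eval (blockVec (1, x, pfaffians x)) Q = 0) :
    ∃ α β : Fin 5 → ℂ, ∀ (u : ℂ) (b c z : Fin 5 → ℂ), b ⬝ᵥ z = 0 → c ⬝ᵥ z = 1 →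
      eval (blockVec (u, wedge b c, ![z 0, -z 1, z 2, -z 3, z 4])) Q =
        α ⬝ᵥ (u • z) + β ⬝ᵥ b := by
  obtain ⟨B, hB⟩ := exists_bilin_of_isHomogeneous_two hQ
  set e := blockVec (1, 0, 0) with he
  let I : (Fin 10 → ℂ) →ₗ[ℂ] (Fin 16 → ℂ) :=
    blockVec ∘ₗ LinearMap.inr ℂ ℂ _ ∘ₗ LinearMap.inl ℂ _ _
  let K : (Fin 5 → ℂ) →ₗ[ℂ] (Fin 16 → ℂ) :=
    blockVec ∘ₗ LinearMap.inr ℂ ℂ _ ∘ₗ LinearMap.inr ℂ _ _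
  have hblock : ∀ u x y, blockVec (u, x, y) = u • e + I x + K y := blockVec_eq
  have hexp : ∀ (t : ℂ) (x), B e e + t * (B e (I x) + B (I x) e)
      + t ^ 2 * (B e (K (pfaffians x)) + B (K (pfaffians x)) e + B (I x) (I x))
      + t ^ 3 * (B (I x) (K (pfaffians x)) + B (K (pfaffians x)) (I x))
      + t ^ 4 * B (K (pfaffians x)) (K (pfaffians x)) = 0 := by
    intro t x
    have h := hv (t • x)
    rw [hB, hblock, pfaffians_smul] at h
    simp only [map_add, map_smul, LinearMap.add_apply, LinearMap.smul_apply, smul_eq_mul] at h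
    linear_combination h
  have hee : B e e = 0 := by simpa using hexp 0 0
  have hex : ∀ x, B e (I x) + B (I x) e = 0 := fun x => by
    linear_combination (2 / 3) * hexp 1 x - (2 / 3) * hexp (-1) x - (1 / 12) * hexp 2 x
      + (1 / 12) * hexp (-2) x
  have hxx : ∀ x, B e (K (pfaffians x)) + B (K (pfaffians x)) e + B (I x) (I x) = 0 := fun x => by
    linear_combination (2 / 3) * hexp 1 x + (2 / 3) * hexp (-1) x - (1 / 24) * hexp 2 x
      - (1 / 24) * hexp (-2) x - (5 / 4) * hee
  have hxp : ∀ x, B (I x) (K (pfaffians x)) + B (K (pfaffians x)) (I x) = 0 := fun x => by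
    linear_combination -(1 / 6) * hexp 1 x + (1 / 6) * hexp (-1) x + (1 / 12) * hexp 2 x
      - (1 / 12) * hexp (-2) x
  have hpp : ∀ x, B (K (pfaffians x)) (K (pfaffians x)) = 0 := fun x => by
    linear_combination -(1 / 6) * hexp 1 x - (1 / 6) * hexp (-1) x + (1 / 24) * hexp 2 x
      + (1 / 24) * hexp (-2) x + (1 / 4) * hee
  have hyy : ∀ y, B (K y) (K y) = 0 := fun y => by
    have hsum := bilin_apply_eq_sum (B.compl₁₂ K K)
    simp only [LinearMap.compl₁₂_apply] at hsum
    rw [hsum]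
    exact eq_zero_of_pfaffians _ (fun x => by rw [← hsum, hpp]) y
  have hT := bilin_apply_eq_sum (B.compl₁₂ I K + (B.compl₁₂ K I).flip)
  simp only [LinearMap.compl₁₂_apply, LinearMap.add_apply, LinearMap.flip_apply] at hT
  obtain ⟨β, hβ⟩ := exists_of_pfaffian_syzygy _ fun x => by rw [← hT, hxp]
  let f : (Fin 5 → ℂ) →ₗ[ℂ] ℂ := B e ∘ₗ K + B.flip e ∘ₗ K
  have hf : ∀ y, B e (K y) + B (K y) e = ∑ i, y i * f (Pi.single i 1) := fun y => by
    change f y = _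
    conv_lhs => rw [pi_eq_sum_univ' y]
    simp
  refine ⟨fun i => (-1) ^ (i : ℕ) * f (Pi.single i 1), β, fun u b c z hbz hcz => ?_⟩
  have hw := hxx (wedge b c)
  rw [pfaffians_wedge] at hw
  simp only [map_zero, LinearMap.zero_apply, zero_add] at hw
  rw [hB, hblock, ← hβ b c z hbz hcz, ← hT]
  have hα : (fun i : Fin 5 => (-1) ^ (i : ℕ) * f (Pi.single i 1)) ⬝ᵥ (u • z) =
      u * (B e (K ![z 0, -z 1, z 2, -z 3, z 4]) + B (K ![z 0, -z 1, z 2, -z 3, z 4]) e) := by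
    rw [hf]
    simp [dotProduct, Fin.sum_univ_five]
    ring
  rw [hα]
  simp only [map_add, map_smul, LinearMap.add_apply, LinearMap.smul_apply, smul_eq_mul]
  linear_combination u ^ 2 * hee + u * hex (wedge b c) + hw + hyy _

/-- Eight linear forms on `ℂ⁵ × ℂ⁵` have a common nonzero isotropic zero. -/
lemma exists_isotropic (α β : Fin 8 → Fin 5 → ℂ) :
    ∃ a b : Fin 5 → ℂ, (a ≠ 0 ∨ b ≠ 0) ∧ b ⬝ᵥ a = 0 ∧ ∀ i, α i ⬝ᵥ a + β i ⬝ᵥ b = 0 := by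
  let L : ((Fin 5 → ℂ) × (Fin 5 → ℂ)) →ₗ[ℂ] (Fin 8 → ℂ) :=
    (Matrix.mulVecLin (Matrix.of α)).coprod (Matrix.mulVecLin (Matrix.of β))
  suffices h : ∃ w ∈ LinearMap.ker L, w ≠ 0 ∧ w.2 ⬝ᵥ w.1 = 0 by
    obtain ⟨⟨a, b⟩, hker, hne, hiso⟩ := h
    refine ⟨a, b, ?_, hiso, fun i => congrFun (LinearMap.mem_ker.mp hker) i⟩
    contrapose! hne
    simp [hne]
  have hrank : 1 < Module.finrank ℂ (LinearMap.ker L) := by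
    have h1 := L.finrank_range_add_finrank_ker
    have h2 := (LinearMap.range L).finrank_le
    simp only [Module.finrank_prod, Module.finrank_fin_fun] at h1 h2
    omega
  have : Nontrivial (LinearMap.ker L) :=
    Module.nontrivial_of_finrank_pos (R := ℂ) (by omega)
  obtain ⟨q, hq⟩ := exists_ne (0 : LinearMap.ker L)
  obtain ⟨p, hqp⟩ := exists_linearIndependent_pair_of_one_lt_finrank hrank hq
  by_cases hqq : q.1.2 ⬝ᵥ q.1.1 = 0
  · exact ⟨q, q.2, by simpa using hq, hqq⟩
  obtain ⟨t, ht⟩ := exists_quadratic_eq_zero (b := q.1.2 ⬝ᵥ p.1.1 + p.1.2 ⬝ᵥ q.1.1)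
    (c := p.1.2 ⬝ᵥ p.1.1) hqq (IsAlgClosed.exists_eq_mul_self _)
  refine ⟨(t • q + p : LinearMap.ker L), Subtype.property _, fun h0 => ?_, ?_⟩
  · have h0' : t • q + (1 : ℂ) • p = 0 := by
      rw [one_smul]; exact Subtype.ext h0
    exact one_ne_zero (LinearIndependent.pair_iff.mp hqp t 1 h0').2
  · simp only [Submodule.coe_add, Submodule.coe_smul, Prod.fst_add, Prod.snd_add, Prod.smul_fst,
      Prod.smul_snd, add_dotProduct, dotProduct_add, smul_dotProduct, dotProduct_smul, smul_eq_mul]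
    linear_combination ht

lemma exists_secant_data {a b : Fin 5 → ℂ} (hba : b ⬝ᵥ a = 0) :
    ∃ (u : ℂ) (c z : Fin 5 → ℂ), u • z = a ∧ b ⬝ᵥ z = 0 ∧ c ⬝ᵥ z = 1 := by
  have key : ∃ (u : ℂ) (z : Fin 5 → ℂ), z ≠ 0 ∧ u • z = a ∧ b ⬝ᵥ z = 0 := by
    by_cases ha : a = 0
    · by_cases hb : b 0 = 0
      · exact ⟨0, Pi.single 0 1, by simp, by simp [ha], by simp [hb]⟩
      · refine ⟨0, ![-b 1, b 0, 0, 0, 0], fun h => hb (congrFun h 1), by simp [ha], ?_⟩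
        simp [dotProduct, Fin.sum_univ_succ]
        ring
    · exact ⟨1, a, ha, one_smul _ _, hba⟩
  obtain ⟨u, z, hz, hu, hbz⟩ := key
  obtain ⟨i, hi⟩ := Function.ne_iff.mp hz
  exact ⟨u, Pi.single i (z i)⁻¹, z, hu, hbz, by simpa using inv_mul_cancel₀ hi⟩

/-- Quadrics vanishing on the spinor variety. -/
def spinorQuadric : Fin 5 ⊕ Fin 5 → MvPolynomial (Fin 16) ℂ :=
  Sum.elim
    ![X 0 * X 11 - (X 5 * X 10 - X 6 * X 9 + X 7 * X 8),
      X 0 * X 12 - (X 2 * X 10 - X 3 * X 9 + X 4 * X 8),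
      X 0 * X 13 - (X 1 * X 10 - X 3 * X 7 + X 4 * X 6),
      X 0 * X 14 - (X 1 * X 9 - X 2 * X 7 + X 4 * X 5),
      X 0 * X 15 - (X 1 * X 8 - X 2 * X 6 + X 3 * X 5)]
    ![-X 1 * X 12 + X 2 * X 13 - X 3 * X 14 + X 4 * X 15,
      -X 1 * X 11 + X 5 * X 13 - X 6 * X 14 + X 7 * X 15,
      -X 2 * X 11 + X 5 * X 12 - X 8 * X 14 + X 9 * X 15,
      -X 3 * X 11 + X 6 * X 12 - X 8 * X 13 + X 10 * X 15,
      -X 4 * X 11 + X 7 * X 12 - X 9 * X 13 + X 10 * X 14]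

lemma eval_spinorQuadric_smul (t : ℂ) (x : Fin 10 → ℂ) (i : Fin 5 ⊕ Fin 5) :
    eval (t • blockVec (1, x, pfaffians x)) (spinorQuadric i) = 0 := by
  rcases i with i | i <;> fin_cases i <;>
    simp [spinorQuadric, blockVec, pfaffians] <;> ring

lemma eq_zero_of_eval_spinorQuadric {u : ℂ} {b c z : Fin 5 → ℂ} (hbz : b ⬝ᵥ z = 0)
    (hcz : c ⬝ᵥ z = 1)
    (h : ∀ i, eval (blockVec (u, wedge b c, ![z 0, -z 1, z 2, -z 3, z 4]))
      (spinorQuadric i) = 0) : u • z = 0 ∧ b = 0 := by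
  simp only [dotProduct, Fin.sum_univ_five] at hbz hcz
  constructor
  · ext i
    have := h (Sum.inl i)
    fin_cases i <;>
      simp [spinorQuadric, blockVec, wedge, -mul_eq_zero] at this ⊢ <;>
      first | linear_combination this | linear_combination -this
  · ext i
    have := h (Sum.inr i)
    fin_cases i <;> simp [spinorQuadric, blockVec, wedge] at this ⊢
    · linear_combination this - b 0 * hcz + c 0 * hbz
    · linear_combination this - b 1 * hcz + c 1 * hbz
    · linear_combination this - b 2 * hcz + c 2 * hbz
    · linear_combination this - b 3 * hcz + c 3 * hbz
    · linear_combination this - b 4 * hcz + c 4 * hbz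

lemma pVanish_mk_iff {m : ℕ} {Q : MvPolynomial (Fin m) ℂ} (hQ : Q.IsHomogeneous 2)
    {v : Fin m → ℂ} (hv : v ≠ 0) :
    PVanish Q (Projectivization.mk ℂ v hv) ↔ eval v Q = 0 := by
  obtain ⟨B, hB⟩ := exists_bilin_of_isHomogeneous_two hQ
  simp only [PVanish, Projectivization.submodule_mk, Submodule.mem_span_singleton]
  refine ⟨fun h => h v ⟨1, one_smul _ _⟩, ?_⟩
  rintro h _ ⟨t, rfl⟩
  rw [hB] at h ⊢
  simp [h]

lemma mk_blockVec_mem_spinor10 (x : Fin 10 → ℂ) (h : blockVec (1, x, pfaffians x) ≠ 0) :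
    Projectivization.mk ℂ _ h ∈ Spinor10 := by
  rintro C ⟨-, hC⟩
  refine hC ⟨skewOf x, skewOf_skew x, ?_⟩
  simp only [spinorVec_skewOf]
  exact ⟨h, trivial⟩

lemma pVanish_spinorQuadric {x : PS 16} (hx : x ∈ Spinor10) (i : Fin 5 ⊕ Fin 5) :
    PVanish (spinorQuadric i) x := by
  refine hx (ZeroLocus (Set.range spinorQuadric)) ⟨⟨_, rfl⟩, ?_⟩ _ ⟨i, rfl⟩
  rintro _ ⟨A, -, hv, rfl⟩ _ ⟨j, rfl⟩ v hmem
  rw [Projectivization.submodule_mk, Submodule.mem_span_singleton] at hmem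
  obtain ⟨t, rfl⟩ := hmem
  rw [spinorVec_eq_blockVec]
  exact eval_spinorQuadric_smul t _ j

end PaperQV

/-- **Proposition 4.12 (i).** The 10-dimensional spinor variety `S¹⁰ ⊆ ℙ¹⁵`
is not scheme-theoretically defined by `8` quadric hypersurfaces. -/
theorem spinor_not_cut_out_by_eight_quadrics :
    ¬ ∃ Q : Fin 8 → MvPolynomial (Fin 16) ℂ,
      (∀ i, (Q i).IsHomogeneous 2) ∧ SchemeCutOutBy Spinor10 Q := by
  rintro ⟨Q, hQ, hX, -⟩
  have hvan : ∀ i x, MvPolynomial.eval (blockVec (1, x, pfaffians x)) (Q i) = 0 := by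
    intro i x
    have h0 : blockVec (1, x, pfaffians x) ≠ 0 := fun h => one_ne_zero (congrFun h 0)
    have hmem := mk_blockVec_mem_spinor10 x h0
    rw [hX] at hmem
    exact (pVanish_mk_iff (hQ i) h0).mp (hmem i)
  choose α β hαβ using fun i => exists_eval_secant (hQ i) (hvan i)
  obtain ⟨a, b, hab, hba, hker⟩ := exists_isotropic α β
  obtain ⟨u, c, z, rfl, hbz, hcz⟩ := exists_secant_data hba
  set v := blockVec (u, wedge b c, ![z 0, -z 1, z 2, -z 3, z 4]) with hv
  have hv0 : v ≠ 0 := by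
    intro h0
    obtain ⟨h1, h2⟩ := eq_zero_of_eval_spinorQuadric (u := u) hbz hcz fun i => by
      rw [← hv, h0, ← zero_smul ℂ (blockVec (1, 0, pfaffians 0))]
      exact eval_spinorQuadric_smul 0 0 i
    exact hab.elim (fun h => h h1) fun h => h h2
  have hmem : Projectivization.mk ℂ v hv0 ∈ Spinor10 := by
    rw [hX]
    exact fun i => (pVanish_mk_iff (hQ i) hv0).mpr ((hαβ i u b c z hbz hcz).trans (hker i))
  obtain ⟨h1, h2⟩ := eq_zero_of_eval_spinorQuadric (u := u) hbz hcz fun i =>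
    pVanish_spinorQuadric hmem i v (by
      rw [Projectivization.submodule_mk]; exact Submodule.mem_span_singleton_self v)
  exact hab.elim (fun h => h h1) fun h => h h2
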